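/- arXiv:2601.03853 — 6 statements merged into one kernel-verified Lean document; each statement's English description precedes it below -/
import Mathlib

section
/- Let B be a nonempty finite set of real numbers, let X : B → ℝ be nondecreasing and let P : B → ℝ be arbitrary. For each v ∈ ℝ define U_v : B → ℝ by U_v(b) := X(b)·v − P(b), and let b*(v) denote the largest element of the (nonempty, finite) set argmax_{b ∈ B} U_v(b). Then b* is nondecreasing: for all v', v ∈ ℝ with v' ≤ v one has b*(v') ≤ b*(v). -/
/-- Let `B` be a nonempty finite set of reals, `X : B → ℝ` nondecreasing,
`P : B → ℝ` arbitrary. Writing `U_v(b) = X b * v - P b`, if `bv` is the largest element of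
`argmax_{b ∈ B} U_v(b)` and `bv'` is the largest element of `argmax_{b ∈ B} U_{v'}(b)` with
`v' ≤ v`, then `bv' ≤ bv`. -/
theorem largest_argmax_bid_monotone
    (B : Finset ℝ) (hB : B.Nonempty) (X P : ℝ → ℝ)
    (hX : ∀ b ∈ B, ∀ b' ∈ B, b ≤ b' → X b ≤ X b')
    (v' v : ℝ) (hvv : v' ≤ v) (bv bv' : ℝ)
    (hbv : bv ∈ B ∧ (∀ c ∈ B, X c * v - P c ≤ X bv * v - P bv) ∧
      ∀ c ∈ B, (∀ d ∈ B, X d * v - P d ≤ X c * v - P c) → c ≤ bv)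
    (hbv' : bv' ∈ B ∧ (∀ c ∈ B, X c * v' - P c ≤ X bv' * v' - P bv') ∧
      ∀ c ∈ B, (∀ d ∈ B, X d * v' - P d ≤ X c * v' - P c) → c ≤ bv') :
    bv' ≤ bv := by
  obtain ⟨hmem, hmax, hlargest⟩ := hbv
  obtain ⟨hmem', hmax', -⟩ := hbv'
  by_contra! hlt
  have hdiff : 0 ≤ (X bv' - X bv) * (v - v') :=
    mul_nonneg (sub_nonneg.2 (hX bv hmem bv' hmem' hlt.le)) (sub_nonneg.2 hvv)
  have hopt : X bv * v - P bv ≤ X bv' * v - P bv' := by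
    linarith [hmax' bv hmem]
  exact hlt.not_ge (hlargest bv' hmem' fun d hd => (hmax d hd).trans hopt)
end

section
/- Fix integers K ≥ 1 and T ≥ 1 and let B := {j/K : j = 0,1,…,K}. Let μ be a Borel probability measure on [0,1]. For each t = 1,…,T let X_t : B → [0,1] be nondecreasing and P_t : B → [0,1] be arbitrary, and for a Borel-measurable strategy s : [0,1] → B define u_t(s) := ∫_{[0,1]} (X_t(s(v))·v − P_t(s(v))) dμ(v). Then the supremum of Σ_{t=1}^{T} u_t(s) over all Borel-measurable strategies s : [0,1] → B equals the supremum over all nondecreasing strategies s : [0,1] → B, and this common supremum is attained by some nondecreasing strategy. -/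
open MeasureTheory

/-- The finite bid set `B = {j/K : j = 0,…,K}`. -/
def BidSet (K : ℕ) : Set ℝ := {b | ∃ j ≤ K, b = (j : ℝ) / K}

/-- The bidder's expected utility `u(s) = ∫_{[0,1]} (X(s v) * v - P(s v)) dμ(v)`
from a bidding strategy `s`. -/
noncomputable def util (μ : Measure ℝ) (X P : ℝ → ℝ) (s : ℝ → ℝ) : ℝ :=
  ∫ v in Set.Icc (0 : ℝ) 1, (X (s v) * v - P (s v)) ∂μ

/-- Maximizers of a finite family of affine functions with nondecreasing slopes can be chosen
monotonically in the argument. -/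
theorem exists_monotone_argmax (K : ℕ) (a p : ℕ → ℝ)
    (ha : ∀ j ≤ K, ∀ j' ≤ K, j ≤ j' → a j ≤ a j') :
    ∃ J : ℝ → ℕ, Monotone J ∧ (∀ v, J v ≤ K) ∧
      ∀ v, ∀ j ≤ K, a j * v - p j ≤ a (J v) * v - p (J v) := by
  classical
  let Q : ℝ → ℕ → Prop := fun v i => ∀ j ≤ K, a j * v - p j ≤ a i * v - p i
  have hle : ∀ v, Nat.findGreatest (Q v) K ≤ K := fun v => Nat.findGreatest_le K
  have hspec : ∀ v, Q v (Nat.findGreatest (Q v) K) := by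
    intro v
    obtain ⟨m, hm, hmax⟩ := Finset.exists_max_image (Finset.range (K + 1))
      (fun j => a j * v - p j) ⟨0, by simp⟩
    exact Nat.findGreatest_spec (P := Q v) (Nat.lt_succ_iff.mp (Finset.mem_range.mp hm))
      fun j hj => hmax j (Finset.mem_range.mpr (Nat.lt_succ_of_le hj))
  refine ⟨fun v => Nat.findGreatest (Q v) K, fun v w hvw => ?_, hle, hspec⟩
  by_contra! hlt
  refine absurd (Nat.le_findGreatest (P := Q w) (hle v) fun j hj => ?_) hlt.not_ge
  have hw := hspec w j hj
  have hv := hspec v _ (hle w)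
  have hslope := ha _ (hle w) _ (hle v) hlt.le
  nlinarith [mul_nonneg (sub_nonneg.mpr hslope) (sub_nonneg.mpr hvw)]

theorem BidSet.finite (K : ℕ) : (BidSet K).Finite := by
  refine ((Set.finite_Iic K).image fun j : ℕ => (j : ℝ) / K).subset ?_
  rintro _ ⟨j, hj, rfl⟩
  exact ⟨j, hj, rfl⟩

/-- Composing an arbitrary function with a measurable strategy valued in the finite bid set gives
a measurable function. -/
theorem aemeasurable_comp_of_mem_bidSet {K : ℕ} {ν : Measure ℝ} {s : ℝ → ℝ} (Y : ℝ → ℝ)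
    (hs : AEMeasurable s ν) (hmem : ∀ᵐ v ∂ν, s v ∈ BidSet K) :
    AEMeasurable (fun v => Y (s v)) ν := by
  have hY : Measurable ((BidSet K).indicator Y) :=
    (measurable_const (a := (0 : ℝ))).measurable_of_countable_ne <|
      (BidSet.finite K).countable.mono fun b hb => by
        by_contra h
        exact hb (Set.indicator_of_notMem h Y).symm
  refine (hY.comp_aemeasurable hs).congr ?_
  filter_upwards [hmem] with v hv
  exact Set.indicator_of_mem hv Y

/-- The utility integrand is integrable for every almost everywhere measurable strategy. -/
theorem integrableOn_util {K : ℕ} {μ : Measure ℝ} [IsFiniteMeasure μ] {X P s : ℝ → ℝ}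
    (hX : ∀ j ≤ K, X ((j : ℝ) / K) ∈ Set.Icc (0 : ℝ) 1)
    (hP : ∀ j ≤ K, P ((j : ℝ) / K) ∈ Set.Icc (0 : ℝ) 1)
    (hs : AEMeasurable s (μ.restrict (Set.Icc 0 1)))
    (hmem : ∀ v ∈ Set.Icc (0 : ℝ) 1, s v ∈ BidSet K) :
    IntegrableOn (fun v => X (s v) * v - P (s v)) (Set.Icc 0 1) μ := by
  have hae := ae_restrict_of_forall_mem (μ := μ) measurableSet_Icc hmem
  refine Integrable.of_bound (C := 1)
    (((aemeasurable_comp_of_mem_bidSet X hs hae).mul aemeasurable_id').sub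
      (aemeasurable_comp_of_mem_bidSet P hs hae)).aestronglyMeasurable ?_
  refine ae_restrict_of_forall_mem measurableSet_Icc fun v hv => ?_
  obtain ⟨j, hj, hsj⟩ := hmem v hv
  obtain ⟨hX0, hX1⟩ := hX j hj
  obtain ⟨hP0, hP1⟩ := hP j hj
  rw [hsj, Real.norm_eq_abs, abs_le]
  have h0 := mul_nonneg hX0 hv.1
  have h1 := mul_le_one₀ hX1 hv.1 hv.2
  constructor <;> linarith

/-- **monotone bidding strategies suffice.** The supremum of the cumulative
utility over all Borel-measurable strategies `s : [0,1] → B` equals the supremum over all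
nondecreasing strategies, and the common supremum is attained by a nondecreasing strategy. -/
theorem monotone_strategies_suffice
    (K T : ℕ) (hK : 1 ≤ K) (hT : 1 ≤ T)
    (μ : Measure ℝ) [IsProbabilityMeasure μ] (hμ : μ (Set.Icc (0 : ℝ) 1) = 1)
    (X P : ℕ → ℝ → ℝ)
    (hX01 : ∀ t < T, ∀ j ≤ K, X t ((j : ℝ) / K) ∈ Set.Icc (0 : ℝ) 1)
    (hXmono : ∀ t < T, ∀ j ≤ K, ∀ j' ≤ K, j ≤ j' →
      X t ((j : ℝ) / K) ≤ X t ((j' : ℝ) / K))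
    (hP01 : ∀ t < T, ∀ j ≤ K, P t ((j : ℝ) / K) ∈ Set.Icc (0 : ℝ) 1) :
    sSup {r : ℝ | ∃ s : ℝ → ℝ, Measurable s ∧ (∀ v ∈ Set.Icc (0 : ℝ) 1, s v ∈ BidSet K) ∧
        r = ∑ t ∈ Finset.range T, util μ (X t) (P t) s}
      = sSup {r : ℝ | ∃ s : ℝ → ℝ, MonotoneOn s (Set.Icc (0 : ℝ) 1) ∧
          (∀ v ∈ Set.Icc (0 : ℝ) 1, s v ∈ BidSet K) ∧
          r = ∑ t ∈ Finset.range T, util μ (X t) (P t) s} ∧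
    ∃ s : ℝ → ℝ, MonotoneOn s (Set.Icc (0 : ℝ) 1) ∧
      (∀ v ∈ Set.Icc (0 : ℝ) 1, s v ∈ BidSet K) ∧
      (∑ t ∈ Finset.range T, util μ (X t) (P t) s)
        = sSup {r : ℝ | ∃ s : ℝ → ℝ, Measurable s ∧
            (∀ v ∈ Set.Icc (0 : ℝ) 1, s v ∈ BidSet K) ∧
            r = ∑ t ∈ Finset.range T, util μ (X t) (P t) s} := by
  obtain ⟨J, hJmono, hJle, hJmax⟩ := exists_monotone_argmax K
    (fun j => ∑ t ∈ Finset.range T, X t ((j : ℝ) / K))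
    (fun j => ∑ t ∈ Finset.range T, P t ((j : ℝ) / K))
    (fun j hj j' hj' h => Finset.sum_le_sum fun t ht =>
      hXmono t (Finset.mem_range.mp ht) j hj j' hj' h)
  let S : ℝ → ℝ := fun v => (J v : ℝ) / K
  have hSmono : Monotone S := fun v w h => by
    have := hJmono h
    dsimp only [S]
    gcongr
  have hSmem : ∀ v ∈ Set.Icc (0 : ℝ) 1, S v ∈ BidSet K := fun v _ => ⟨J v, hJle v, rfl⟩
  have hint : ∀ s : ℝ → ℝ, AEMeasurable s (μ.restrict (Set.Icc 0 1)) →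
      (∀ v ∈ Set.Icc (0 : ℝ) 1, s v ∈ BidSet K) → ∀ t ∈ Finset.range T,
      IntegrableOn (fun v => X t (s v) * v - P t (s v)) (Set.Icc 0 1) μ :=
    fun s hs hmem t ht => integrableOn_util (hX01 t (Finset.mem_range.mp ht))
      (hP01 t (Finset.mem_range.mp ht)) hs hmem
  have hSint := hint S hSmono.measurable.aemeasurable hSmem
  have hbest : ∀ s : ℝ → ℝ, AEMeasurable s (μ.restrict (Set.Icc 0 1)) →
      (∀ v ∈ Set.Icc (0 : ℝ) 1, s v ∈ BidSet K) →
      ∑ t ∈ Finset.range T, util μ (X t) (P t) s ≤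
        ∑ t ∈ Finset.range T, util μ (X t) (P t) S := by
    intro s hs hmem
    have hsint := hint s hs hmem
    simp only [util]
    rw [← integral_finsetSum _ hsint, ← integral_finsetSum _ hSint]
    refine setIntegral_mono_on (integrable_finsetSum _ hsint) (integrable_finsetSum _ hSint)
      measurableSet_Icc fun v hv => ?_
    obtain ⟨j, hj, hsj⟩ := hmem v hv
    simpa only [hsj, S, Finset.sum_sub_distrib, Finset.sum_mul] using hJmax v j hj
  have hmeas : IsGreatest {r : ℝ | ∃ s : ℝ → ℝ, Measurable s ∧
      (∀ v ∈ Set.Icc (0 : ℝ) 1, s v ∈ BidSet K) ∧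
      r = ∑ t ∈ Finset.range T, util μ (X t) (P t) s}
      (∑ t ∈ Finset.range T, util μ (X t) (P t) S) := by
    refine ⟨⟨S, hSmono.measurable, hSmem, rfl⟩, ?_⟩
    rintro _ ⟨s, hs, hmem, rfl⟩
    exact hbest s hs.aemeasurable hmem
  have hmon : IsGreatest {r : ℝ | ∃ s : ℝ → ℝ, MonotoneOn s (Set.Icc (0 : ℝ) 1) ∧
      (∀ v ∈ Set.Icc (0 : ℝ) 1, s v ∈ BidSet K) ∧
      r = ∑ t ∈ Finset.range T, util μ (X t) (P t) s}
      (∑ t ∈ Finset.range T, util μ (X t) (P t) S) := by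
    refine ⟨⟨S, hSmono.monotoneOn _, hSmem, rfl⟩, ?_⟩
    rintro _ ⟨s, hs, hmem, rfl⟩
    exact hbest s (aemeasurable_restrict_of_monotoneOn measurableSet_Icc hs) hmem
  exact ⟨hmeas.csSup_eq.trans hmon.csSup_eq.symm,
    S, hSmono.monotoneOn _, hSmem, hmeas.csSup_eq.symm⟩
end

section
/- Fix integers K ≥ 1 and T ≥ 1 and let B := {j/K : j = 0,1,…,K}. Let μ be a Borel probability measure on [0,1] with continuous CDF F(v) := μ([0,v]) and quantile function φ(q) := inf{v ∈ [0,1] : F(v) ≥ q}. Let Δ := {π ∈ ℝ^{K+1} : π_k ≥ 0 for all k and Σ_{k=1}^{K+1} π_k = 1}, with partial sums Π_0(π) := 0 and Π_j(π) := Σ_{ℓ=1}^{j} π_ℓ, and let s_π : [0,1] → B be the quantile bidding strategy: s_π(v) := 0 for v ∈ [0, φ(Π_1(π))], s_π(v) := (j−1)/K for v ∈ (φ(Π_{j−1}(π)), φ(Π_j(π))] (2 ≤ j ≤ K+1), and s_π(v) := 1 for v > φ(1). For t = 1,…,T let X_t : B → [0,1] and P_t : B → [0,1] be arbitrary functions and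 define u_t(s) := ∫_{[0,1]} (X_t(s(v))·v − P_t(s(v))) dμ(v). Then the supremum of Σ_{t=1}^{T} u_t(s) over all nondecreasing strategies s : [0,1] → B equals the supremum of Σ_{t=1}^{T} u_t(s_π) over all π ∈ Δ. -/
open MeasureTheory

/-- The CDF `F(v) = μ([0,v])` of a measure on `[0,1]`. -/
noncomputable def cdf (μ : Measure ℝ) (v : ℝ) : ℝ := (μ (Set.Icc 0 v)).toReal

/-- The quantile function `φ(q) = inf {v ∈ [0,1] : F(v) ≥ q}`. -/
noncomputable def quant (μ : Measure ℝ) (q : ℝ) : ℝ :=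
  sInf {v : ℝ | v ∈ Set.Icc (0 : ℝ) 1 ∧ q ≤ cdf μ v}

open scoped Classical in
/-- The quantile bidding strategy `s_π` of a quantile strategy `π` (indexed `π 0,…,π K`),
with respect to the value distribution `μ` with quantile function `φ = quant μ`:
`s_π v` counts the partial-sum thresholds `φ(Π_i)` (for `i = 1,…,K`, where
`Π_i = Σ_{ℓ<i} π ℓ`) lying strictly below `v`, divided by `K`.  Since `φ` and the partial
sums are nondecreasing, this is exactly the piecewise description: `s_π v = 0` on
`[0, φ(Π₁)]`, `s_π v = (j−1)/K` on `(φ(Π_{j−1}), φ(Π_j)]` for `2 ≤ j ≤ K+1`, and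
`s_π v = 1` for `v > φ(1)`. -/
noncomputable def sQ (K : ℕ) (μ : Measure ℝ) (π : ℕ → ℝ) (v : ℝ) : ℝ :=
  (((Finset.Icc 1 K).filter
      (fun i => quant μ (∑ ℓ ∈ Finset.range i, π ℓ) < v)).card : ℝ) / K

theorem sQ_monotone (K : ℕ) (μ : Measure ℝ) (π : ℕ → ℝ) : Monotone (sQ K μ π) := by
  intro v w hvw
  unfold sQ
  gcongr

theorem sQ_mem_bidSet (K : ℕ) (μ : Measure ℝ) (π : ℕ → ℝ) (v : ℝ) : sQ K μ π v ∈ BidSet K :=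
  ⟨_, (Finset.card_filter_le _ _).trans (by simp), rfl⟩

/-- For a continuous CDF, the quantile function is a right inverse of the CDF. -/
theorem quant_mem_and_cdf_quant (μ : Measure ℝ) [IsProbabilityMeasure μ]
    (hμ : μ (Set.Icc (0 : ℝ) 1) = 1) (hF : ContinuousOn (cdf μ) (Set.Icc 0 1))
    (hF0 : cdf μ 0 = 0) {q : ℝ} (hq : q ∈ Set.Icc (0 : ℝ) 1) :
    quant μ q ∈ Set.Icc (0 : ℝ) 1 ∧ cdf μ (quant μ q) = q := by
  set S : Set ℝ := {v | v ∈ Set.Icc (0 : ℝ) 1 ∧ q ≤ cdf μ v}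
  have hbdd : BddBelow S := ⟨0, fun v hv => hv.1.1⟩
  have hclosed : IsClosed S := hF.preimage_isClosed_of_isClosed isClosed_Icc isClosed_Ici
  have hne : S.Nonempty := ⟨1, by simp, by simpa [cdf, hμ] using hq.2⟩
  have hmem : quant μ q ∈ S := hclosed.csInf_mem hne hbdd
  refine ⟨hmem.1, ?_⟩
  obtain ⟨c, hc, hcq⟩ := intermediate_value_Icc hmem.1.1
    (hF.mono (Set.Icc_subset_Icc_right hmem.1.2)) ⟨hF0.trans_le hq.1, hmem.2⟩
  have hle : quant μ q ≤ c := csInf_le hbdd ⟨⟨hc.1, hc.2.trans hmem.1.2⟩, hcq.ge⟩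
  rwa [le_antisymm hle hc.2]

/-- A lower subset of `[0,1]` agrees almost everywhere with the initial interval ending at the
quantile of its measure. -/
theorem ae_quant_lt_iff_notMem (μ : Measure ℝ) [IsProbabilityMeasure μ]
    (hμ : μ (Set.Icc (0 : ℝ) 1) = 1) (hF : ContinuousOn (cdf μ) (Set.Icc 0 1))
    (hF0 : cdf μ 0 = 0) {A : Set ℝ} (hA : A ⊆ Set.Icc 0 1)
    (hlower : ∀ x ∈ A, ∀ y ∈ Set.Icc (0 : ℝ) 1, y ≤ x → y ∈ A) :
    ∀ᵐ v ∂μ, v ∈ Set.Icc (0 : ℝ) 1 → (quant μ (μ.real A) < v ↔ v ∉ A) := by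
  obtain ⟨ha, hcdf⟩ := quant_mem_and_cdf_quant μ hμ hF hF0
    (q := μ.real A) ⟨measureReal_nonneg, measureReal_le_one⟩
  set a := quant μ (μ.real A)
  have hmeas : μ (Set.Icc 0 a) = μ A :=
    (ENNReal.toReal_eq_toReal_iff' (measure_ne_top _ _) (measure_ne_top _ _)).1 hcdf
  have hAmeas : MeasurableSet A := by
    refine Set.OrdConnected.measurableSet ⟨fun x hx y hy z hz => ?_⟩
    exact hlower y hy z ⟨(hA hx).1.trans hz.1, hz.2.trans (hA hy).2⟩ hz.2
  have hae : A =ᵐ[μ] Set.Icc 0 a := by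
    by_cases h : a ∈ A
    · refine (ae_eq_of_subset_of_measure_ge (fun v hv => ?_) hmeas.ge
        measurableSet_Icc.nullMeasurableSet (measure_ne_top _ _)).symm
      exact hlower a h v ⟨hv.1, hv.2.trans ha.2⟩ hv.2
    · refine ae_eq_of_subset_of_measure_ge (fun v hv => ⟨(hA hv).1, ?_⟩) hmeas.le
        hAmeas.nullMeasurableSet (measure_ne_top _ _)
      by_contra! hav
      exact h (hlower v hv a ha hav.le)
  filter_upwards [hae.mem_iff] with v hv hv01
  rw [hv, Set.mem_Icc, not_and, not_le]
  exact ⟨fun h _ => h, fun h => h hv01.1⟩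

/-- Every monotone strategy agrees almost everywhere on `[0,1]` with a quantile strategy. -/
theorem exists_ae_eq_sQ (K : ℕ) (hK : 1 ≤ K) (μ : Measure ℝ) [IsProbabilityMeasure μ]
    (hμ : μ (Set.Icc (0 : ℝ) 1) = 1) (hF : ContinuousOn (cdf μ) (Set.Icc 0 1))
    (hF0 : cdf μ 0 = 0) {s : ℝ → ℝ} (hs : MonotoneOn s (Set.Icc (0 : ℝ) 1))
    (hsB : ∀ v ∈ Set.Icc (0 : ℝ) 1, s v ∈ BidSet K) :
    ∃ π : ℕ → ℝ, (∀ k, 0 ≤ π k) ∧ ∑ k ∈ Finset.range (K + 1), π k = 1 ∧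
      ∀ᵐ v ∂μ, v ∈ Set.Icc (0 : ℝ) 1 → s v = sQ K μ π v := by
  have hKpos : (0 : ℝ) < K := by exact_mod_cast hK
  let A : ℕ → Set ℝ := fun i => {v | v ∈ Set.Icc (0 : ℝ) 1 ∧ s v < (i : ℝ) / K}
  have hA0 : A 0 = ∅ := by
    refine Set.eq_empty_of_forall_notMem fun v hv => ?_
    obtain ⟨j, -, hj⟩ := hsB v hv.1
    have hneg := hv.2
    rw [hj, Nat.cast_zero, zero_div] at hneg
    exact hneg.not_ge (by positivity)
  have hAtop : A (K + 1) = Set.Icc 0 1 := by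
    refine Set.Subset.antisymm (fun v hv => hv.1) fun v hv => ⟨hv, ?_⟩
    obtain ⟨j, hjK, hj⟩ := hsB v hv
    rw [hj]
    gcongr
    omega
  have hAmono : ∀ i, A i ⊆ A (i + 1) := fun i v hv =>
    ⟨hv.1, hv.2.trans_le (by gcongr; omega)⟩
  let π : ℕ → ℝ := fun k => μ.real (A (k + 1)) - μ.real (A k)
  have hsum : ∀ i, ∑ k ∈ Finset.range i, π k = μ.real (A i) := fun i => by
    simp [π, Finset.sum_range_sub (fun k => μ.real (A k)), hA0]
  refine ⟨π, fun k => sub_nonneg.2 (measureReal_mono (hAmono k)), ?_, ?_⟩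
  · rw [hsum, hAtop, measureReal_def, hμ, ENNReal.toReal_one]
  have hae : ∀ᵐ v ∂μ, ∀ i, v ∈ Set.Icc (0 : ℝ) 1 → (quant μ (μ.real (A i)) < v ↔ v ∉ A i) :=
    ae_all_iff.2 fun i => ae_quant_lt_iff_notMem μ hμ hF hF0 (fun v hv => hv.1)
      fun x hx y hy hyx => ⟨hy, (hs hy hx.1 hyx).trans_lt hx.2⟩
  filter_upwards [hae] with v hv hv01
  obtain ⟨j, hjK, hj⟩ := hsB v hv01
  have hcount : {i ∈ Finset.Icc 1 K | quant μ (∑ ℓ ∈ Finset.range i, π ℓ) < v}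
      = Finset.Icc 1 j := by
    ext i
    have hmem : v ∈ A i ↔ j < i := by
      simp only [A, Set.mem_ofPred_eq, hv01, true_and, hj]
      rw [div_lt_div_iff_of_pos_right hKpos, Nat.cast_lt]
    rw [Finset.mem_filter, hsum, hv i hv01, hmem, Finset.mem_Icc, Finset.mem_Icc]
    omega
  have hcard := congrArg Finset.card hcount
  rw [Nat.card_Icc, Nat.add_sub_cancel] at hcard
  rw [hj, ← hcard, sQ]

/-- **quantile reformulation.** The supremum of the cumulative utility over
all nondecreasing strategies `s : [0,1] → B` equals the supremum over quantile strategies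
`π ∈ Δ` of the cumulative utility of the induced quantile bidding strategy `s_π`. -/
theorem quantile_reformulation
    (K T : ℕ) (hK : 1 ≤ K) (hT : 1 ≤ T)
    (μ : Measure ℝ) [IsProbabilityMeasure μ] (hμ : μ (Set.Icc (0 : ℝ) 1) = 1)
    (hFcont : ContinuousOn (cdf μ) (Set.Icc 0 1)) (hF0 : cdf μ 0 = 0)
    (X P : ℕ → ℝ → ℝ)
    (hX01 : ∀ t < T, ∀ j ≤ K, X t ((j : ℝ) / K) ∈ Set.Icc (0 : ℝ) 1)
    (hP01 : ∀ t < T, ∀ j ≤ K, P t ((j : ℝ) / K) ∈ Set.Icc (0 : ℝ) 1) :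
    sSup {r : ℝ | ∃ s : ℝ → ℝ, MonotoneOn s (Set.Icc (0 : ℝ) 1) ∧
        (∀ v ∈ Set.Icc (0 : ℝ) 1, s v ∈ BidSet K) ∧
        r = ∑ t ∈ Finset.range T, util μ (X t) (P t) s}
      = sSup {r : ℝ | ∃ π : ℕ → ℝ, (∀ k < K + 1, 0 ≤ π k) ∧
          (∑ k ∈ Finset.range (K + 1), π k = 1) ∧
          r = ∑ t ∈ Finset.range T, util μ (X t) (P t) (sQ K μ π)} := by
  congr 1
  ext r
  constructor
  · rintro ⟨s, hs, hsB, rfl⟩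
    obtain ⟨π, hπ, hsum, hae⟩ := exists_ae_eq_sQ K hK μ hμ hFcont hF0 hs hsB
    refine ⟨π, fun k _ => hπ k, hsum, Finset.sum_congr rfl fun t _ => ?_⟩
    refine setIntegral_congr_ae measurableSet_Icc ?_
    filter_upwards [hae] with v hv hv01
    rw [hv hv01]
  · rintro ⟨π, -, -, rfl⟩
    exact ⟨sQ K μ π, (sQ_monotone K μ π).monotoneOn _, fun v _ => sQ_mem_bidSet K μ π v, rfl⟩
end

section
/- Fix an integer K ≥ 1. Let φ : [0,1] → ℝ be a nondecreasing (hence Lebesgue-integrable on [0,1]) function, let x_1 ≤ x_2 ≤ … ≤ x_{K+1} be real numbers, and let p_1,…,p_{K+1} be arbitrary real numbers. Define Q : Δ → ℝ on the standard simplex Δ := {π ∈ ℝ^{K+1} : π_k ≥ 0, Σ_{k=1}^{K+1} π_k = 1} by Q(π) := Σ_{j=1}^{K+1} ∫_{Π_{j−1}(π)}^{Π_j(π)} (x_j·φ(z) − p_j) dz, where Π_0(π) := 0 and Π_j(π) := Σ_{ℓ=1}^{j} π_ℓ. Then Q is concave on Δ: for all π, π' ∈ Δ and λ ∈ [0,1],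 Q(λπ + (1−λ)π') ≥ λQ(π) + (1−λ)Q(π'). -/
open MeasureTheory

/-- The quantile utility `Q(π) = Σ_{j=0}^{K} ∫_{Π_j}^{Π_{j+1}} (x_j·φ(z) − p_j) dz`
of a quantile strategy `π` (indexed `π 0,…,π K`, with partial sums `Π_j = Σ_{ℓ<j} π ℓ`). -/
noncomputable def Qfun (K : ℕ) (φ : ℝ → ℝ) (x p : ℕ → ℝ) (π : ℕ → ℝ) : ℝ :=
  ∑ j ∈ Finset.range (K + 1),
    ∫ z in (∑ ℓ ∈ Finset.range j, π ℓ)..(∑ ℓ ∈ Finset.range (j + 1), π ℓ),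
      (x j * φ z - p j)

lemma MonotoneOn.intervalIntegrable_of_mem_Icc {φ : ℝ → ℝ} (hφ : MonotoneOn φ (Set.Icc 0 1))
    {u v : ℝ} (hu : u ∈ Set.Icc (0 : ℝ) 1) (hv : v ∈ Set.Icc (0 : ℝ) 1) :
    IntervalIntegrable φ volume u v :=
  (hφ.mono (Set.OrdConnected.uIcc_subset Set.ordConnected_Icc hu hv)).intervalIntegrable

/-- Supporting line inequality for the primitive of a monotone function. -/
lemma MonotoneOn.mul_sub_le_intervalIntegral {φ : ℝ → ℝ} (hφ : MonotoneOn φ (Set.Icc 0 1))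
    {a c : ℝ} (ha : a ∈ Set.Icc (0 : ℝ) 1) (hc : c ∈ Set.Icc (0 : ℝ) 1) :
    φ c * (a - c) ≤ ∫ z in c..a, φ z := by
  rcases le_total c a with h | h
  · have := intervalIntegral.integral_mono_on h (intervalIntegrable_const (c := φ c))
      (hφ.intervalIntegrable_of_mem_Icc hc ha) fun z hz => hφ hc ⟨hc.1.trans hz.1, hz.2.trans ha.2⟩ hz.1
    rw [intervalIntegral.integral_const, smul_eq_mul] at this
    linarith
  · have := intervalIntegral.integral_mono_on h (hφ.intervalIntegrable_of_mem_Icc ha hc)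
      (intervalIntegrable_const (c := φ c))
      fun z hz => hφ ⟨ha.1.trans hz.1, hz.2.trans hc.2⟩ hc hz.2
    rw [intervalIntegral.integral_const, smul_eq_mul] at this
    rw [intervalIntegral.integral_symm]
    linarith

/-- The primitive of a function that is monotone on the unit interval is convex there. -/
lemma MonotoneOn.convexOn_intervalIntegral {φ : ℝ → ℝ} (hφ : MonotoneOn φ (Set.Icc 0 1)) :
    ConvexOn ℝ (Set.Icc 0 1) fun t => ∫ z in (0 : ℝ)..t, φ z := by
  refine ⟨convex_Icc 0 1, fun a ha b hb l m hl hm hlm => ?_⟩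
  have hc := convex_Icc (0 : ℝ) 1 ha hb hl hm hlm
  simp only [smul_eq_mul] at hc ⊢
  set c := l * a + m * b with hcdef
  have h0 : (0 : ℝ) ∈ Set.Icc (0 : ℝ) 1 := by simp
  have h1 := hφ.mul_sub_le_intervalIntegral ha hc
  have h2 := hφ.mul_sub_le_intervalIntegral hb hc
  rw [← intervalIntegral.integral_interval_sub_left
      (hφ.intervalIntegrable_of_mem_Icc h0 ha)
      (hφ.intervalIntegrable_of_mem_Icc h0 hc)] at h1
  rw [← intervalIntegral.integral_interval_sub_left
      (hφ.intervalIntegrable_of_mem_Icc h0 hb)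
      (hφ.intervalIntegrable_of_mem_Icc h0 hc)] at h2
  have h3 := add_le_add (mul_le_mul_of_nonneg_left h1 hl) (mul_le_mul_of_nonneg_left h2 hm)
  obtain rfl : m = 1 - l := by linarith
  have h4 : l * (φ c * (a - c)) + (1 - l) * (φ c * (b - c)) = 0 := by
    rw [hcdef]; ring
  linarith

/-- Summation by parts for the increments of a sequence. -/
lemma sum_range_succ_mul_sub (x F : ℕ → ℝ) (n : ℕ) :
    ∑ j ∈ Finset.range (n + 1), x j * (F (j + 1) - F j) =
      x n * F (n + 1) - x 0 * F 0 - ∑ j ∈ Finset.range n, (x (j + 1) - x j) * F (j + 1) := by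
  induction n with
  | zero => simp; ring
  | succ n ih => rw [Finset.sum_range_succ, ih, Finset.sum_range_succ _ n]; ring

lemma sum_range_mem_Icc {n : ℕ} {π : ℕ → ℝ} (h0 : ∀ k < n, 0 ≤ π k)
    (h1 : ∑ k ∈ Finset.range n, π k = 1) {j : ℕ} (hj : j ≤ n) :
    ∑ k ∈ Finset.range j, π k ∈ Set.Icc (0 : ℝ) 1 := by
  refine ⟨Finset.sum_nonneg fun k hk => h0 k ((Finset.mem_range.1 hk).trans_le hj), ?_⟩
  rw [← h1]
  exact Finset.sum_le_sum_of_subset_of_nonneg (Finset.range_subset_range.2 hj)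
    fun k hk _ => h0 k (Finset.mem_range.1 hk)

/-- The quantile utility in terms of the primitive of `φ`, after summation by parts. -/
lemma Qfun_eq (K : ℕ) {φ : ℝ → ℝ} (hφ : MonotoneOn φ (Set.Icc 0 1)) (x p : ℕ → ℝ) {π : ℕ → ℝ}
    (h0 : ∀ k < K + 1, 0 ≤ π k) (h1 : ∑ k ∈ Finset.range (K + 1), π k = 1) :
    Qfun K φ x p π = x K * (∫ z in (0 : ℝ)..1, φ z)
      - ∑ j ∈ Finset.range K,
          (x (j + 1) - x j) * (∫ z in (0 : ℝ)..(∑ ℓ ∈ Finset.range (j + 1), π ℓ), φ z)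
      - ∑ j ∈ Finset.range (K + 1), p j * π j := by
  have hz : (0 : ℝ) ∈ Set.Icc (0 : ℝ) 1 := by simp
  have key := sum_range_succ_mul_sub x
    (fun j => ∫ z in (0 : ℝ)..(∑ ℓ ∈ Finset.range j, π ℓ), φ z) K
  simp only [h1, Finset.range_zero, Finset.sum_empty, intervalIntegral.integral_same, mul_zero,
    sub_zero] at key
  rw [← key, ← Finset.sum_sub_distrib]
  refine Finset.sum_congr rfl fun j hj => ?_
  have hj := Finset.mem_range.1 hj
  have ha := sum_range_mem_Icc h0 h1 hj.le
  have hb := sum_range_mem_Icc h0 h1 (Nat.succ_le_of_lt hj)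
  rw [intervalIntegral.integral_sub
      ((hφ.intervalIntegrable_of_mem_Icc ha hb).const_mul _) intervalIntegrable_const,
    intervalIntegral.integral_const_mul, intervalIntegral.integral_const, smul_eq_mul,
    intervalIntegral.integral_interval_sub_left
      (hφ.intervalIntegrable_of_mem_Icc hz hb)
      (hφ.intervalIntegrable_of_mem_Icc hz ha),
    Finset.sum_range_succ _ j]
  ring

/-- **concavity of the quantile utility.** If `φ : [0,1] → ℝ` is
nondecreasing and `x 0 ≤ x 1 ≤ … ≤ x K`, then `Q` is concave on the standard simplex
`Δ = {π : π k ≥ 0, Σ_{k=0}^{K} π k = 1}`. -/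
theorem quantile_utility_concave
    (K : ℕ) (hK : 1 ≤ K)
    (φ : ℝ → ℝ) (hφ : MonotoneOn φ (Set.Icc 0 1))
    (x p : ℕ → ℝ) (hx : ∀ j < K, x j ≤ x (j + 1))
    (π π' : ℕ → ℝ)
    (hπ0 : ∀ k < K + 1, 0 ≤ π k) (hπ1 : ∑ k ∈ Finset.range (K + 1), π k = 1)
    (hπ'0 : ∀ k < K + 1, 0 ≤ π' k) (hπ'1 : ∑ k ∈ Finset.range (K + 1), π' k = 1)
    (l : ℝ) (hl : l ∈ Set.Icc (0 : ℝ) 1) :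
    l * Qfun K φ x p π + (1 - l) * Qfun K φ x p π'
      ≤ Qfun K φ x p (fun k => l * π k + (1 - l) * π' k) := by
  obtain ⟨hl0, hl1⟩ := hl
  have hl1' : 0 ≤ 1 - l := by linarith
  have hmix : ∀ n, ∑ k ∈ Finset.range n, (l * π k + (1 - l) * π' k) =
      l * ∑ k ∈ Finset.range n, π k + (1 - l) * ∑ k ∈ Finset.range n, π' k := fun n => by
    rw [Finset.sum_add_distrib, Finset.mul_sum, Finset.mul_sum]
  have hm0 : ∀ k < K + 1, 0 ≤ l * π k + (1 - l) * π' k := fun k hk =>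
    add_nonneg (mul_nonneg hl0 (hπ0 k hk)) (mul_nonneg hl1' (hπ'0 k hk))
  have hm1 : ∑ k ∈ Finset.range (K + 1), (l * π k + (1 - l) * π' k) = 1 := by
    rw [hmix, hπ1, hπ'1]; ring
  rw [Qfun_eq K hφ x p hπ0 hπ1, Qfun_eq K hφ x p hπ'0 hπ'1, Qfun_eq K hφ x p hm0 hm1]
  have hpay : ∑ j ∈ Finset.range (K + 1), p j * (l * π j + (1 - l) * π' j) =
      l * ∑ j ∈ Finset.range (K + 1), p j * π j
        + (1 - l) * ∑ j ∈ Finset.range (K + 1), p j * π' j := by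
    rw [Finset.mul_sum, Finset.mul_sum, ← Finset.sum_add_distrib]
    exact Finset.sum_congr rfl fun j _ => by ring
  have hconv : ∑ j ∈ Finset.range K, (x (j + 1) - x j) *
        (∫ z in (0 : ℝ)..(∑ k ∈ Finset.range (j + 1), (l * π k + (1 - l) * π' k)), φ z) ≤
      l * ∑ j ∈ Finset.range K, (x (j + 1) - x j) *
        (∫ z in (0 : ℝ)..(∑ k ∈ Finset.range (j + 1), π k), φ z)
      + (1 - l) * ∑ j ∈ Finset.range K, (x (j + 1) - x j) *
        (∫ z in (0 : ℝ)..(∑ k ∈ Finset.range (j + 1), π' k), φ z) := by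
    rw [Finset.mul_sum, Finset.mul_sum, ← Finset.sum_add_distrib]
    refine Finset.sum_le_sum fun j hj => ?_
    have hj := Finset.mem_range.1 hj
    have h := hφ.convexOn_intervalIntegral.2
      (sum_range_mem_Icc hπ0 hπ1 (show j + 1 ≤ K + 1 by lia))
      (sum_range_mem_Icc hπ'0 hπ'1 (show j + 1 ≤ K + 1 by lia)) hl0 hl1' (by ring)
    simp only [smul_eq_mul] at h
    rw [hmix]
    linarith [mul_le_mul_of_nonneg_left h (sub_nonneg.2 (hx j hj))]
  linarith
end

section
/- Fix an integer K ≥ 1. Let μ be a Borel probability measure on [0,1] with continuous CDF F(v) := μ([0,v]) and quantile function φ(q) := inf{v ∈ [0,1] : F(v) ≥ q}. Let π be in the standard simplex Δ ⊂ ℝ^{K+1}, with Π_0(π) := 0 and Π_j(π) := Σ_{ℓ=1}^{j} π_ℓ, and let 0 ≤ x_1 ≤ x_2 ≤ … ≤ x_{K+1} ≤ 1. Define the step allocation x̃ : [0,1] → [0,1] by x̃(v) := x_1 for v ∈ [0, φ(Π_1(π))], x̃(v) := x_j for v ∈ (φ(Π_{j−1}(π)), φ(Π_j(π))] (2 ≤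 j ≤ K+1), and x̃(v) := x_{K+1} for v > φ(1), and the Myerson payment p̃(v) := x̃(v)·v − ∫_0^v x̃(z) dz. Then ∫_{[0,1]} p̃(v) dμ(v) = Σ_{j=1}^{K} Σ_{k=j+1}^{K+1} π_k·(x_{j+1} − x_j)·φ(Π_j(π)). -/
open MeasureTheory

lemma cdf_mono (μ : Measure ℝ) [IsFiniteMeasure μ] : Monotone (cdf μ) := fun _ _ h =>
  ENNReal.toReal_mono (measure_ne_top _ _) (measure_mono (Set.Icc_subset_Icc_right h))

lemma bddBelow_quant (μ : Measure ℝ) (q : ℝ) :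
    BddBelow {v : ℝ | v ∈ Set.Icc (0 : ℝ) 1 ∧ q ≤ cdf μ v} :=
  ⟨0, fun _ h => h.1.1⟩

lemma cdf_one {μ : Measure ℝ} (hμ : μ (Set.Icc (0 : ℝ) 1) = 1) : cdf μ 1 = 1 := by
  simp [cdf, hμ]

lemma quant_mono {μ : Measure ℝ} (hμ : μ (Set.Icc (0 : ℝ) 1) = 1) {p q : ℝ} (hpq : p ≤ q)
    (hq : q ≤ 1) : quant μ p ≤ quant μ q :=
  csInf_le_csInf (bddBelow_quant μ p) ⟨1, by simp, by rwa [cdf_one hμ]⟩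
    fun _ h => ⟨h.1, hpq.trans h.2⟩

lemma quant_mem {μ : Measure ℝ} (hμ : μ (Set.Icc (0 : ℝ) 1) = 1)
    (hF : ContinuousOn (cdf μ) (Set.Icc 0 1)) {q : ℝ} (hq : q ≤ 1) :
    quant μ q ∈ Set.Icc (0 : ℝ) 1 ∧ q ≤ cdf μ (quant μ q) := by
  have hclosed : IsClosed {v : ℝ | v ∈ Set.Icc (0 : ℝ) 1 ∧ q ≤ cdf μ v} :=
    hF.preimage_isClosed_of_isClosed isClosed_Icc isClosed_Ici
  exact hclosed.csInf_mem ⟨1, by simp, by rwa [cdf_one hμ]⟩ (bddBelow_quant μ q)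

/-- A continuous CDF is a left inverse of its quantile function. -/
lemma cdf_quant {μ : Measure ℝ} [IsFiniteMeasure μ] (hμ : μ (Set.Icc (0 : ℝ) 1) = 1)
    (hF : ContinuousOn (cdf μ) (Set.Icc 0 1)) (hF0 : cdf μ 0 = 0) {q : ℝ} (hq0 : 0 ≤ q)
    (hq : q ≤ 1) : cdf μ (quant μ q) = q := by
  refine le_antisymm ?_ (quant_mem hμ hF hq).2
  obtain ⟨v, hv, rfl⟩ : q ∈ cdf μ '' Set.Icc 0 1 :=
    intermediate_value_Icc zero_le_one hF (by simp [hF0, cdf_one hμ, hq0, hq])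
  exact cdf_mono μ (csInf_le (bddBelow_quant μ _) ⟨hv, le_rfl⟩)

lemma measureReal_Ioi_inter_Icc {μ : Measure ℝ} [IsFiniteMeasure μ]
    (hμ : μ (Set.Icc (0 : ℝ) 1) = 1) {a : ℝ} (ha : a ∈ Set.Icc (0 : ℝ) 1) :
    μ.real (Set.Ioi a ∩ Set.Icc 0 1) = 1 - cdf μ a := by
  have hset : Set.Ioi a ∩ Set.Icc 0 1 = Set.Icc 0 1 \ Set.Icc 0 a := by
    ext z
    simp only [Set.mem_inter_iff, Set.mem_Ioi, Set.mem_Icc, Set.mem_sdiff]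
    grind
  rw [hset, measureReal_sdiff (Set.Icc_subset_Icc_right ha.2) measurableSet_Icc]
  simp [Measure.real, hμ, cdf]

lemma intervalIntegrable_indicator_Ioi (a u v : ℝ) :
    IntervalIntegrable ((Set.Ioi a).indicator (1 : ℝ → ℝ)) volume u v := by
  refine Monotone.intervalIntegrable fun s t hst => ?_
  simp only [Set.indicator_apply, Set.mem_Ioi, Pi.one_apply]
  grind

lemma integral_indicator_Ioi {a v : ℝ} (ha : 0 ≤ a) (hv : 0 ≤ v) :
    ∫ z in (0 : ℝ)..v, (Set.Ioi a).indicator (1 : ℝ → ℝ) z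
      = (Set.Ioi a).indicator (1 : ℝ → ℝ) v * (v - a) := by
  have hset : Set.Ioi a ∩ Set.Ioc 0 v = Set.Ioc a v := by
    ext z
    simp only [Set.mem_inter_iff, Set.mem_Ioi, Set.mem_Ioc]
    grind
  rw [intervalIntegral.integral_of_le hv, integral_indicator_one measurableSet_Ioi,
    measureReal_restrict_apply measurableSet_Ioi, hset, Real.volume_real_Ioc]
  by_cases h : a < v
  · simp [h, h.le]
  · simp [h, not_lt.1 h]

/-- A step function with monotone breakpoints `a 1 ≤ … ≤ a (K + 1)` is a sum of jumps. -/
lemma step_eq_sum_indicator {K : ℕ} {a x : ℕ → ℝ} {f : ℝ → ℝ}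
    (ha : ∀ i j, i ≤ j → j ≤ K + 1 → a i ≤ a j)
    (h0 : ∀ v, 0 ≤ v → v ≤ a 1 → f v = x 0)
    (hj : ∀ j, 2 ≤ j → j ≤ K + 1 → ∀ v, a (j - 1) < v → v ≤ a j → f v = x (j - 1))
    (h1 : ∀ v, a (K + 1) < v → f v = x K) {v : ℝ} (hv : 0 ≤ v) :
    f v = x 0 + ∑ j ∈ Finset.range K,
      (x (j + 1) - x j) * (Set.Ioi (a (j + 1))).indicator 1 v := by
  have above : ∀ n ≤ K + 1, a n < v → ∑ j ∈ Finset.range n,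
      (x (j + 1) - x j) * (Set.Ioi (a (j + 1))).indicator 1 v = x n - x 0 := by
    intro n hn hav
    rw [← Finset.sum_range_sub]
    refine Finset.sum_congr rfl fun j hjn => ?_
    have hlt : a (j + 1) < v := (ha _ _ (Finset.mem_range.1 hjn) hn).trans_lt hav
    simp [hlt]
  have below : ∀ n ≤ K, v ≤ a (n + 1) → f v = x 0 + ∑ j ∈ Finset.range n,
      (x (j + 1) - x j) * (Set.Ioi (a (j + 1))).indicator 1 v := by
    intro n
    induction n with
    | zero => intro _ h; simpa using h0 v hv h
    | succ n ih =>
      intro hn h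
      rcases le_or_gt v (a (n + 1)) with hle | hlt
      · rw [Finset.sum_range_succ, ih (by omega) hle]
        simp [hle]
      · rw [hj (n + 2) (by omega) (by omega) v hlt h, above (n + 1) (by omega) hlt]
        simp
  rcases le_or_gt v (a (K + 1)) with hle | hlt
  · exact below K le_rfl hle
  · rw [h1 v hlt, above K (by omega) ((ha _ _ (by omega) le_rfl).trans_lt hlt)]
    ring

/-- **expected revenue of the auxiliary auction.** With `π ∈ Δ ⊆ ℝ^{K+1}`
(indexed `π 0,…,π K`, partial sums `Π_j = Σ_{ℓ<j} π ℓ`), allocation levels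
`0 ≤ x 0 ≤ … ≤ x K ≤ 1`, the step allocation `x̃` (given in piecewise form as hypotheses:
`x̃ v = x 0` on `[0, φ(Π₁)]`, `x̃ v = x_{j−1}` on `(φ(Π_{j−1}), φ(Π_j)]` for `2 ≤ j ≤ K+1`,
`x̃ v = x K` for `v > φ(1)`), and the Myerson payment `p̃(v) = x̃(v)·v − ∫_0^v x̃(z) dz`,
one has `∫_{[0,1]} p̃ dμ = Σ_{j=1}^{K} Σ_{k=j+1}^{K+1} π_k·(x_{j+1} − x_j)·φ(Π_j)`
(written below with 0-based indices). -/
theorem auxiliary_auction_revenue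
    (K : ℕ) (hK : 1 ≤ K)
    (μ : Measure ℝ) [IsProbabilityMeasure μ] (hμ : μ (Set.Icc (0 : ℝ) 1) = 1)
    (hFcont : ContinuousOn (cdf μ) (Set.Icc 0 1)) (hF0 : cdf μ 0 = 0)
    (π : ℕ → ℝ) (hπ0 : ∀ k < K + 1, 0 ≤ π k)
    (hπ1 : ∑ k ∈ Finset.range (K + 1), π k = 1)
    (x : ℕ → ℝ)
    (hx0 : 0 ≤ x 0) (hxmono : ∀ j < K, x j ≤ x (j + 1)) (hx1 : x K ≤ 1)
    (xt : ℝ → ℝ)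
    (ht0 : ∀ v, 0 ≤ v → v ≤ quant μ (∑ ℓ ∈ Finset.range 1, π ℓ) → xt v = x 0)
    (htj : ∀ j, 2 ≤ j → j ≤ K + 1 → ∀ v,
      quant μ (∑ ℓ ∈ Finset.range (j - 1), π ℓ) < v →
      v ≤ quant μ (∑ ℓ ∈ Finset.range j, π ℓ) → xt v = x (j - 1))
    (ht1 : ∀ v, quant μ 1 < v → xt v = x K) :
    ∫ v in Set.Icc (0 : ℝ) 1, (xt v * v - ∫ z in (0 : ℝ)..v, xt z) ∂μ
      = ∑ j ∈ Finset.range K, (∑ k ∈ Finset.Icc (j + 1) K, π k) *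
          ((x (j + 1) - x j) * quant μ (∑ ℓ ∈ Finset.range (j + 1), π ℓ)) := by
  set a : ℕ → ℝ := fun n => quant μ (∑ ℓ ∈ Finset.range n, π ℓ) with ha_def
  have hP_mono : ∀ i j, i ≤ j → j ≤ K + 1 →
      ∑ ℓ ∈ Finset.range i, π ℓ ≤ ∑ ℓ ∈ Finset.range j, π ℓ := fun i j hij hjK =>
    Finset.sum_le_sum_of_subset_of_nonneg (Finset.range_mono hij) fun k hk _ =>
      hπ0 k (by have := Finset.mem_range.1 hk; omega)
  have hP_one : ∀ j ≤ K + 1, ∑ ℓ ∈ Finset.range j, π ℓ ≤ 1 := fun j hj =>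
    hπ1 ▸ hP_mono j (K + 1) hj le_rfl
  have hP_nonneg : ∀ j ≤ K + 1, 0 ≤ ∑ ℓ ∈ Finset.range j, π ℓ := fun j hj => by
    simpa using hP_mono 0 j (Nat.zero_le j) hj
  have ha_mem : ∀ j ≤ K + 1, a j ∈ Set.Icc (0 : ℝ) 1 := fun j hj =>
    (quant_mem hμ hFcont (hP_one j hj)).1
  have hstep : ∀ v, 0 ≤ v → xt v = x 0 + ∑ j ∈ Finset.range K,
      (x (j + 1) - x j) * (Set.Ioi (a (j + 1))).indicator 1 v := fun v hv =>
    step_eq_sum_indicator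
      (fun i j hij hjK => quant_mono hμ (hP_mono i j hij hjK) (hP_one j hjK)) ht0 htj
      (by simpa only [ha_def, hπ1] using ht1) hv
  have hpay : ∀ v ∈ Set.Icc (0 : ℝ) 1, xt v * v - ∫ z in (0 : ℝ)..v, xt z
      = ∑ j ∈ Finset.range K,
        ((x (j + 1) - x j) * a (j + 1)) * (Set.Ioi (a (j + 1))).indicator 1 v := by
    intro v hv
    have hint : ∀ j ∈ Finset.range K, IntervalIntegrable
        (fun z => (x (j + 1) - x j) * (Set.Ioi (a (j + 1))).indicator (1 : ℝ → ℝ) z)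
        volume 0 v := fun j _ => (intervalIntegrable_indicator_Ioi _ _ _).const_mul _
    have hsum : ∫ z in (0 : ℝ)..v, xt z = x 0 * v + ∑ j ∈ Finset.range K,
        (x (j + 1) - x j) * ((Set.Ioi (a (j + 1))).indicator 1 v * (v - a (j + 1))) := by
      rw [intervalIntegral.integral_congr (g := fun z => x 0 + ∑ j ∈ Finset.range K,
          (x (j + 1) - x j) * (Set.Ioi (a (j + 1))).indicator 1 z)
          fun z hz => hstep z (Set.uIcc_of_le hv.1 ▸ hz).1,
        intervalIntegral.integral_add intervalIntegrable_const
          (by simpa only [Finset.sum_fn] using IntervalIntegrable.sum _ hint),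
        intervalIntegral.integral_finsetSum hint]
      congr 1
      · simp [mul_comm]
      · refine Finset.sum_congr rfl fun j hj => ?_
        rw [intervalIntegral.integral_const_mul, integral_indicator_Ioi
          (ha_mem _ (by have := Finset.mem_range.1 hj; omega)).1 hv.1]
    rw [hsum, hstep v hv.1, add_mul, add_sub_add_left_eq_sub, Finset.sum_mul,
      ← Finset.sum_sub_distrib]
    exact Finset.sum_congr rfl fun j _ => by ring
  rw [setIntegral_congr_fun measurableSet_Icc hpay, integral_finsetSum _ fun j _ =>
    Integrable.const_mul (f := (Set.Ioi (a (j + 1))).indicator (1 : ℝ → ℝ))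
      ((integrable_const (1 : ℝ)).indicator measurableSet_Ioi) _]
  refine Finset.sum_congr rfl fun j hj => ?_
  have hjK : j + 1 ≤ K + 1 := by have := Finset.mem_range.1 hj; omega
  have htail : ∑ k ∈ Finset.Icc (j + 1) K, π k = 1 - ∑ ℓ ∈ Finset.range (j + 1), π ℓ := by
    rw [← hπ1, ← Finset.sum_Ico_eq_sub _ hjK]
    rfl
  rw [integral_const_mul, integral_indicator_one measurableSet_Ioi,
    measureReal_restrict_apply measurableSet_Ioi, measureReal_Ioi_inter_Icc hμ (ha_mem _ hjK),
    cdf_quant hμ hFcont hF0 (hP_nonneg _ hjK) (hP_one _ hjK), htail, mul_comm]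
end

section
/- There exists a constant c > 0 such that for every integer K ≥ 2 there exists T_0 such that for every integer T ≥ T_0 the following holds. Let B := {j/K : j = 0,1,…,K} and let μ be the uniform probability measure on [1 − 1/T, 1]. Call a pair (X, P) an admissible format if X : B → [0,1] is nondecreasing and P : B → [0,1] satisfies P(0) = 0, and for an admissible format define u_{(X,P)}(s) := ∫ (X(s(v))·v − P(s(v))) dμ(v) for Borel-measurable s : [0,1] → B. Then for every algorithm — that is, every family of maps A_t (t = 1,…,T) sending each sequence of admissible formats ((X_1,P_1),…,(X_{t−1},P_{t−1})) to a Borel-measurable strategy s^{(t)} : [0,1] → B — there exists a sequence of admissible formats (X_1,P_1),…,(X_T,P_T) such that, with u_t := u_{(X_t,P_t)} and s^{(t)} := A_t((X_1,P_1),…,(X_{t−1},P_{t−1})), the regret sup over Borel-measurable s : [0,1] → B of Σ_{t=1}^{T} ( u_t(s) − u_t(s^{(t)}) ) is at least c·√(T·log K). -/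
open MeasureTheory

/-- The uniform probability measure on `[1 − 1/T, 1]`. -/
noncomputable def unif (T : ℕ) : Measure ℝ :=
  (T : ENNReal) • (volume.restrict (Set.Icc (1 - 1 / (T : ℝ)) 1))

/-- An admissible single-bidder auction format `(X, P)` on the bid set `B`:
`X : B → [0,1]` nondecreasing (allocation monotonicity) and `P : B → [0,1]` with
`P 0 = 0` (voluntary participation). -/
def Admissible (K : ℕ) (F : (ℝ → ℝ) × (ℝ → ℝ)) : Prop :=
  (∀ j ≤ K, F.1 ((j : ℝ) / K) ∈ Set.Icc (0 : ℝ) 1) ∧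
  (∀ j ≤ K, ∀ j' ≤ K, j ≤ j' → F.1 ((j : ℝ) / K) ≤ F.1 ((j' : ℝ) / K)) ∧
  (∀ j ≤ K, F.2 ((j : ℝ) / K) ∈ Set.Icc (0 : ℝ) 1) ∧
  F.2 0 = 0

/-- A greedy adversary: if the potential `Ψ` does not decrease on average over the next sign, then
signs can be chosen so that `Ψ`, corrected by any predictable transform `a`, does not decrease. -/
theorem exists_signs_potential_le (Ψ a : ℕ → (ℕ → ℝ) → ℝ)
    (ha : ∀ t ε ε', (∀ s < t, ε s = ε' s) → a t ε = a t ε')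
    (hstep : ∀ t ε, 2 * Ψ t ε ≤
      Ψ (t + 1) (Function.update ε t 1) + Ψ (t + 1) (Function.update ε t (-1)))
    (ε₀ : ℕ → ℝ) (hε₀ : ∀ t, ε₀ t = 1 ∨ ε₀ t = -1) (T : ℕ) :
    ∃ ε : ℕ → ℝ, (∀ t, ε t = 1 ∨ ε t = -1) ∧
      Ψ 0 ε₀ ≤ Ψ T ε - ∑ t ∈ Finset.range T, ε t * a t ε := by
  induction T with
  | zero => exact ⟨ε₀, hε₀, by simp⟩
  | succ T ih =>
    obtain ⟨ε, hε, h⟩ := ih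
    have hupd : ∀ e t, t ≤ T → ∀ s < t, Function.update ε T e s = ε s := fun e t ht s hs =>
      Function.update_of_ne (by omega) _ _
    have hsum : ∀ e, ∑ t ∈ Finset.range (T + 1),
        Function.update ε T e t * a t (Function.update ε T e) =
          ∑ t ∈ Finset.range T, ε t * a t ε + e * a T ε := by
      intro e
      rw [Finset.sum_range_succ, Function.update_self, ha T _ ε (hupd e T le_rfl)]
      congr 1
      refine Finset.sum_congr rfl fun t ht => ?_
      have ht' := Finset.mem_range.1 ht
      rw [ha t _ ε (hupd e t ht'.le), hupd e T le_rfl t ht']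
    have hsign : ∀ e : ℝ, (e = 1 ∨ e = -1) → ∀ t, Function.update ε T e t = 1 ∨
        Function.update ε T e t = -1 := by
      intro e he t
      by_cases ht : t = T
      · subst ht; simpa using he
      · simpa [Function.update_of_ne ht] using hε t
    have hs := hstep T ε
    by_cases hc : Ψ T ε ≤ Ψ (T + 1) (Function.update ε T 1) - a T ε
    · refine ⟨Function.update ε T 1, hsign 1 (Or.inl rfl), ?_⟩
      rw [hsum]
      linarith
    · refine ⟨Function.update ε T (-1), hsign (-1) (Or.inr rfl), ?_⟩
      rw [hsum]
      linarith

/-- A quartic polynomial of a simple random walk `S` at time `c` that is a martingale, with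
`α` and `β` the weights of its quadratic and quartic parts. -/
noncomputable def walkPotential (α β c S : ℝ) : ℝ :=
  α * (S ^ 2 - c) - β * (S ^ 4 - 6 * c * S ^ 2 + 3 * c ^ 2 + 2 * c)

theorem walkPotential_step (α β c S : ℝ) :
    walkPotential α β (c + 1) (S + 1) + walkPotential α β (c + 1) (S + -1) =
      2 * walkPotential α β c S := by
  unfold walkPotential; ring

theorem sq_sub_quartic_le_abs (x : ℝ) : x ^ 2 - x ^ 4 / 4 ≤ |x| := by
  rw [← sq_abs x, show x ^ 4 = |x| ^ 4 by rw [← abs_pow, abs_of_nonneg (by positivity)]]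
  have h := abs_nonneg x
  nlinarith [mul_nonneg h (sq_nonneg (|x| - 1)), mul_nonneg h (sq_nonneg (|x| - 3 / 2)),
    mul_nonneg (mul_nonneg h h) (sq_nonneg (|x| - 3 / 2)),
    mul_nonneg (mul_nonneg h h) (sq_nonneg (|x| - 1))]

theorem walkPotential_le_abs {n : ℝ} (hn : 0 < n) :
    ∃ α β : ℝ, ∀ S, walkPotential α β n S + √n / 3 ≤ |S| := by
  obtain ⟨q, hq, rfl⟩ : ∃ q : ℝ, 0 < q ∧ n = q ^ 2 :=
    ⟨√n, Real.sqrt_pos.2 hn, (Real.sq_sqrt hn.le).symm⟩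
  refine ⟨1 / (2 * q) - 6 * (1 / (4 * (2 * q) ^ 3)) * q ^ 2, 1 / (4 * (2 * q) ^ 3), fun S => ?_⟩
  rw [Real.sqrt_sq hq.le]
  have h := mul_le_mul_of_nonneg_left (sq_sub_quartic_le_abs (S / (2 * q)))
    (by positivity : 0 ≤ 2 * q)
  rw [abs_div, abs_of_pos (by positivity : 0 < 2 * q), mul_div_cancel₀ _ (by positivity)] at h
  refine le_trans ?_ h
  have hrem : 2 * q * ((S / (2 * q)) ^ 2 - (S / (2 * q)) ^ 4 / 4) -
      (walkPotential (1 / (2 * q) - 6 * (1 / (4 * (2 * q) ^ 3)) * q ^ 2) (1 / (4 * (2 * q) ^ 3))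
        (q ^ 2) S + q / 3) = 7 * q / 96 + 1 / (16 * q) := by
    unfold walkPotential
    field_simp
    ring
  have : 0 < 7 * q / 96 + 1 / (16 * q) := by positivity
  linarith

/-- The number of rounds before `t` lying in block `k`, for blocks of length `n`. -/
noncomputable def blockCount (n k t : ℕ) : ℝ :=
  ∑ s ∈ Finset.range t, if s / n = k then 1 else 0

/-- The sum of the signs `ε` over the rounds before `t` lying in block `k`. -/
noncomputable def blockSum (n k t : ℕ) (ε : ℕ → ℝ) : ℝ :=
  ∑ s ∈ Finset.range t, if s / n = k then ε s else 0

theorem blockCount_eq {n k m T : ℕ} (hn : 0 < n) (hk : k < m) (hT : m * n ≤ T) :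
    blockCount n k T = n := by
  unfold blockCount
  rw [Finset.sum_boole]
  have : (Finset.range T).filter (fun s => s / n = k) = Finset.Ico (k * n) (k * n + n) := by
    ext s
    have h1 : k * n + n ≤ T := by nlinarith
    simp only [Finset.mem_filter, Finset.mem_range, Finset.mem_Ico, Nat.div_eq_iff hn]
    omega
  rw [this]; simp

theorem blockSum_congr {n k t : ℕ} {ε ε' : ℕ → ℝ} (h : ∀ s < t, ε s = ε' s) :
    blockSum n k t ε = blockSum n k t ε' :=
  Finset.sum_congr rfl fun s hs => by rw [h s (Finset.mem_range.1 hs)]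

theorem blockSum_succ_update (n k t : ℕ) (ε : ℕ → ℝ) (e : ℝ) :
    blockSum n k (t + 1) (Function.update ε t e) =
      blockSum n k t ε + if t / n = k then e else 0 := by
  rw [← blockSum_congr (ε := Function.update ε t e) (ε' := ε)
    fun s hs => Function.update_of_ne hs.ne _ _]
  simp [blockSum, Finset.sum_range_succ]

/-- Signs chosen against a predictable sequence `a` so that the block sums are large in absolute
value by comparison with the transform of the signs by `a`. -/
theorem exists_signs_blockSum (m n T : ℕ) (hn : 0 < n) (hT : m * n ≤ T) (a : ℕ → (ℕ → ℝ) → ℝ)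
    (ha : ∀ t ε ε', (∀ s < t, ε s = ε' s) → a t ε = a t ε') :
    ∃ ε : ℕ → ℝ, (∀ t, ε t = 1 ∨ ε t = -1) ∧
      m * √n / 3 ≤ ∑ k ∈ Finset.range m, |blockSum n k T ε| -
        ∑ t ∈ Finset.range T, ε t * a t ε := by
  obtain ⟨α, β, hαβ⟩ := walkPotential_le_abs (n := n) (by positivity)
  obtain ⟨ε, hε, h⟩ := exists_signs_potential_le
    (fun t ε => ∑ k ∈ Finset.range m, walkPotential α β (blockCount n k t) (blockSum n k t ε)) a
    ha
    (fun t ε => by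
      simp only [blockSum_succ_update]
      rw [Finset.mul_sum, ← Finset.sum_add_distrib]
      refine Finset.sum_le_sum fun k _ => ?_
      have hc : blockCount n k (t + 1) = blockCount n k t + if t / n = k then 1 else 0 :=
        Finset.sum_range_succ _ _
      rw [hc]
      split_ifs
      · exact (walkPotential_step _ _ _ _).ge
      · simp only [add_zero]; linarith)
    (fun _ => 1) (fun _ => Or.inl rfl) T
  refine ⟨ε, hε, ?_⟩
  have h0 : walkPotential α β 0 0 = 0 := by simp [walkPotential]
  simp only [blockCount, blockSum, Finset.range_zero, Finset.sum_empty, h0,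
    Finset.sum_const_zero] at h
  have h1 : ∑ k ∈ Finset.range m, (walkPotential α β (blockCount n k T) (blockSum n k T ε) + √n / 3)
      ≤ ∑ k ∈ Finset.range m, |blockSum n k T ε| := by
    refine Finset.sum_le_sum fun k hk => ?_
    rw [blockCount_eq hn (Finset.mem_range.1 hk) hT]
    exact hαβ _
  rw [Finset.sum_add_distrib, Finset.sum_const, Finset.card_range, nsmul_eq_mul] at h1
  simp only [blockCount, blockSum] at h1 ⊢
  linarith

/-- The index `j` of the bid `b = j / K`. -/
noncomputable def bidIndex (K : ℕ) (b : ℝ) : ℕ := ⌊b * K⌋₊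

theorem bidIndex_div {K : ℕ} (hK : 0 < K) (j : ℕ) : bidIndex K ((j : ℝ) / K) = j := by
  have : (K : ℝ) ≠ 0 := by positivity
  rw [bidIndex, div_mul_cancel₀ _ this, Nat.floor_natCast]

theorem measurable_bidIndex (K : ℕ) : Measurable (bidIndex K) :=
  Nat.measurable_floor.comp (measurable_id.mul_const _)

/-- The format allocating exactly to the nonzero bids, in which the bid `j / K` with `j ≠ 0` pays
`(1 - w j) / 2`. -/
noncomputable def coinFormat (K : ℕ) (w : ℕ → ℝ) : (ℝ → ℝ) × (ℝ → ℝ) :=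
  (fun b => if bidIndex K b = 0 then 0 else 1,
    fun b => if bidIndex K b = 0 then 0 else (1 - w (bidIndex K b)) / 2)

theorem admissible_coinFormat {K : ℕ} (hK : 0 < K) {w : ℕ → ℝ} (hw : ∀ j, |w j| ≤ 1) :
    Admissible K (coinFormat K w) := by
  refine ⟨fun j _ => ?_, fun j _ j' _ hj => ?_, fun j _ => ?_, ?_⟩
  · simp only [coinFormat, bidIndex_div hK]
    split_ifs <;> simp
  · simp only [coinFormat, bidIndex_div hK]
    split_ifs <;> first | omega | norm_num
  · simp only [coinFormat, bidIndex_div hK]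
    have := abs_le.1 (hw j)
    split_ifs
    · simp
    · constructor <;> linarith
  · simp [coinFormat, bidIndex]

section Utility

variable {μ : Measure ℝ} [IsProbabilityMeasure (μ.restrict (Set.Icc (0 : ℝ) 1))]

theorem integrableOn_sub_half : IntegrableOn (fun v : ℝ => v - 1 / 2) (Set.Icc 0 1) μ := by
  refine Integrable.of_bound (by fun_prop) 1 ?_
  filter_upwards [ae_restrict_mem measurableSet_Icc] with v hv
  rw [Real.norm_eq_abs, abs_le]
  constructor <;> linarith [hv.1, hv.2]

theorem integrableOn_bidIndex {K : ℕ} {f : ℕ → ℝ} (hf : ∀ j, |f j| ≤ 1) {s : ℝ → ℝ}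
    (hs : Measurable s) : IntegrableOn (fun v => f (bidIndex K (s v))) (Set.Icc 0 1) μ :=
  Integrable.of_bound
    (((measurable_of_countable f).comp ((measurable_bidIndex K).comp hs)).aestronglyMeasurable) 1
    (ae_of_all _ fun _ => hf _)

theorem integral_bidIndex_le {K : ℕ} {f : ℕ → ℝ} (hf : ∀ j, |f j| ≤ 1) {s : ℝ → ℝ}
    (hs : Measurable s) : ∫ v in Set.Icc (0 : ℝ) 1, f (bidIndex K (s v)) ∂μ ≤ 1 := by
  refine (integral_mono (integrableOn_bidIndex hf hs) (integrable_const (1 : ℝ))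
    fun v => (abs_le.1 (hf _)).2).trans ?_
  simp

theorem util_coinFormat_le (hμ : ∀ᵐ v ∂(μ.restrict (Set.Icc (0 : ℝ) 1)), 1 / 2 ≤ v) {K : ℕ}
    {w : ℕ → ℝ} (hw : ∀ j, |w j| ≤ 1) {s : ℝ → ℝ} (hs : Measurable s) :
    util μ (coinFormat K w).1 (coinFormat K w).2 s ≤
      ∫ v in Set.Icc (0 : ℝ) 1, (v - 1 / 2) ∂μ +
        (∫ v in Set.Icc (0 : ℝ) 1,
          (fun j => if j = 0 then 0 else w j) (bidIndex K (s v)) ∂μ) / 2 := by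
  have hf : ∀ j, |(fun j => if j = 0 then 0 else w j) j| ≤ 1 := by
    intro j
    dsimp only
    split_ifs
    · simp
    · exact hw j
  have hi := integrableOn_bidIndex (μ := μ) (K := K) hf hs
  rw [← integral_div, ← integral_add integrableOn_sub_half (hi.div_const 2)]
  refine integral_mono_ae ?_ (integrableOn_sub_half.add (hi.div_const 2)) ?_
  · refine Integrable.of_bound ?_ 2 ?_
    · have hX : Measurable (coinFormat K w).1 :=
        (measurable_of_countable (fun j : ℕ => if j = 0 then (0 : ℝ) else 1)).comp
          (measurable_bidIndex K)
      have hP : Measurable (coinFormat K w).2 :=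
        (measurable_of_countable (fun j : ℕ => if j = 0 then (0 : ℝ) else (1 - w j) / 2)).comp
          (measurable_bidIndex K)
      exact (((hX.comp hs).mul measurable_id).sub (hP.comp hs)).aestronglyMeasurable
    · filter_upwards [ae_restrict_mem measurableSet_Icc] with v hv
      have := abs_le.1 (hw (bidIndex K (s v)))
      simp only [coinFormat]
      rw [Real.norm_eq_abs, abs_le]
      split_ifs <;> constructor <;> linarith [hv.1, hv.2]
  · filter_upwards [hμ] with v hv
    simp only [coinFormat]
    split_ifs <;> linarith

theorem util_coinFormat_const {K : ℕ} (hK : 0 < K) (w : ℕ → ℝ) {j : ℕ} (hj : j ≠ 0) :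
    util μ (coinFormat K w).1 (coinFormat K w).2 (fun _ => (j : ℝ) / K) =
      ∫ v in Set.Icc (0 : ℝ) 1, (v - 1 / 2) ∂μ + w j / 2 := by
  have : ∀ v : ℝ, (coinFormat K w).1 ((j : ℝ) / K) * v - (coinFormat K w).2 ((j : ℝ) / K) =
      (v - 1 / 2) + w j / 2 := by
    intro v
    simp only [coinFormat, bidIndex_div hK, if_neg hj]
    ring
  simp only [util, this]
  rw [integral_add integrableOn_sub_half (integrable_const _)]
  simp

end Utility

theorem unif_restrict (T : ℕ) (hT : 2 ≤ T) :
    (unif T).restrict (Set.Icc (0 : ℝ) 1) = unif T := by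
  have h : (0 : ℝ) ≤ 1 - 1 / (T : ℝ) := by
    have : (2 : ℝ) ≤ T := by exact_mod_cast hT
    rw [sub_nonneg, div_le_one (by linarith)]
    linarith
  rw [unif, Measure.restrict_smul, Measure.restrict_restrict measurableSet_Icc,
    Set.inter_eq_self_of_subset_right (Set.Icc_subset_Icc_left h)]

theorem isProbabilityMeasure_unif (T : ℕ) (hT : 2 ≤ T) : IsProbabilityMeasure (unif T) := by
  constructor
  have h : (0 : ℝ) < T := by positivity
  simp only [unif, Measure.smul_apply, Measure.restrict_apply_univ, Real.volume_Icc, smul_eq_mul,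
    sub_sub_cancel]
  rw [← ENNReal.ofReal_natCast, ← ENNReal.ofReal_mul h.le, mul_one_div_cancel h.ne',
    ENNReal.ofReal_one]

theorem unif_ae_half_le (T : ℕ) (hT : 2 ≤ T) : ∀ᵐ v ∂(unif T), 1 / 2 ≤ v := by
  refine Measure.ae_smul_measure ?_ _
  filter_upwards [ae_restrict_mem measurableSet_Icc] with v hv
  have : (2 : ℝ) ≤ T := by exact_mod_cast hT
  have := one_div_le_one_div_of_le (by norm_num) this
  linarith [hv.1]

/-- The `k`-th binary digit of `i`, as a sign. -/
def bitSign (i k : ℕ) : ℝ := if i.testBit k then -1 else 1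

theorem exists_bitSign_mul_eq_abs (m : ℕ) (S : ℕ → ℝ) :
    ∃ i < 2 ^ m, ∀ k < m, bitSign i k * S k = |S k| := by
  refine ⟨Nat.ofBits fun k : Fin m => decide (S k < 0), Nat.ofBits_lt_two_pow _, fun k hk => ?_⟩
  rw [bitSign, Nat.testBit_ofBits_lt _ _ hk]
  by_cases h : S k < 0
  · simp [h, abs_of_neg h]
  · simp [h, abs_of_nonneg (not_lt.1 h)]

/-- The sign experienced by bid index `j` in round `t`: the binary digit of `j - 1` belonging to the
current block of length `n`, or `0` after the first `m` blocks. -/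
def roundSign (m n t j : ℕ) : ℝ :=
  if t / n ∈ Finset.range m then bitSign (j - 1) (t / n) else 0

theorem abs_roundSign_le (m n t j : ℕ) : |roundSign m n t j| ≤ 1 := by
  unfold roundSign bitSign
  split_ifs <;> simp

theorem sum_mul_roundSign (m n T j : ℕ) (ε : ℕ → ℝ) :
    ∑ t ∈ Finset.range T, ε t * roundSign m n t j =
      ∑ k ∈ Finset.range m, bitSign (j - 1) k * blockSum n k T ε := by
  simp only [blockSum, Finset.mul_sum]
  rw [Finset.sum_comm]
  refine Finset.sum_congr rfl fun t _ => ?_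
  simp only [mul_ite, mul_zero, Finset.sum_ite_eq, roundSign]
  split_ifs <;> ring

theorem sqrt_mul_log_le {K T : ℕ} (hK : 2 ≤ K) (hT : K ≤ T) :
    1 / 12 * √(T * Real.log K) ≤ (Nat.log 2 K * √(T / Nat.log 2 K : ℕ) / 3) / 2 := by
  set m := Nat.log 2 K with hm
  set n := T / m with hn
  have hm1 : 1 ≤ m := Nat.log_pos (by norm_num) hK
  have hmK : m ≤ K := Nat.log_le_self 2 K
  have hn1 : 1 ≤ n := Nat.div_pos (hmK.trans hT) hm1
  have hTn : T ≤ 2 * (m * n) := by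
    have h1 : m * n + T % m = T := Nat.div_add_mod T m
    have h2 := Nat.mod_lt T hm1
    nlinarith
  have hlog : Real.log K ≤ 2 * m := by
    have h1 : K < 2 ^ (m + 1) := Nat.lt_pow_succ_log_self (by norm_num) K
    have h2 : (K : ℝ) ≤ 2 ^ (m + 1) := by exact_mod_cast h1.le
    have h3 := Real.log_le_log (by positivity) h2
    rw [Real.log_pow] at h3
    have h4 : (1 : ℝ) ≤ m := by exact_mod_cast hm1
    have h5 := Real.log_two_lt_d9
    push_cast at h3
    nlinarith
  have hlog0 : 0 ≤ Real.log K := Real.log_natCast_nonneg K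
  have hTn' : (T : ℝ) ≤ 2 * (m * n) := by exact_mod_cast hTn
  have h : √(T * Real.log K) ≤ 2 * (m * √n) := by
    rw [Real.sqrt_le_left (by positivity), mul_pow, mul_pow, Real.sq_sqrt (by positivity)]
    calc (T : ℝ) * Real.log K ≤ 2 * (m * n) * (2 * m) := by gcongr
      _ = _ := by ring
  linarith

/-- **regret lower bound.** There is a constant `c > 0` such that for
every `K ≥ 2` there is `T₀` such that for every `T ≥ T₀` and every algorithm `A`
(mapping each history of admissible formats to a Borel-measurable strategy into `B`),
there is a sequence of admissible formats against which the algorithm's regret — the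
supremum over Borel-measurable strategies of the cumulative utility difference — is at
least `c·√(T·log K)`, where the bidder's value is uniform on `[1 − 1/T, 1]`. -/
theorem regret_lower_bound :
    ∃ c : ℝ, 0 < c ∧ ∀ K : ℕ, 2 ≤ K → ∃ T₀ : ℕ, ∀ T : ℕ, T₀ ≤ T →
      ∀ A : (t : ℕ) → (Fin t → (ℝ → ℝ) × (ℝ → ℝ)) → (ℝ → ℝ),
        (∀ (t : ℕ) (h : Fin t → (ℝ → ℝ) × (ℝ → ℝ)),
          Measurable (A t h) ∧ ∀ v ∈ Set.Icc (0 : ℝ) 1, A t h v ∈ BidSet K) →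
        ∃ F : ℕ → (ℝ → ℝ) × (ℝ → ℝ),
          (∀ t < T, Admissible K (F t)) ∧
          c * Real.sqrt (T * Real.log K) ≤
            sSup {r : ℝ | ∃ s : ℝ → ℝ, Measurable s ∧
              (∀ v ∈ Set.Icc (0 : ℝ) 1, s v ∈ BidSet K) ∧
              r = ∑ t ∈ Finset.range T,
                (util (unif T) (F t).1 (F t).2 s
                  - util (unif T) (F t).1 (F t).2 (A t (fun i : Fin t => F i.val)))} := by
  refine ⟨1 / 12, by norm_num, fun K hK => ⟨K, fun T hT A hA => ?_⟩⟩
  have hK0 : 0 < K := by omega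
  have hT2 : 2 ≤ T := hK.trans hT
  set m := Nat.log 2 K with hm
  set n := T / m with hn
  have hn0 : 0 < n :=
    Nat.div_pos ((Nat.log_le_self 2 K).trans hT) (Nat.log_pos (by norm_num) hK)
  have : IsProbabilityMeasure ((unif T).restrict (Set.Icc (0 : ℝ) 1)) := by
    rw [unif_restrict T hT2]
    exact isProbabilityMeasure_unif T hT2
  have hhalf : ∀ᵐ v ∂((unif T).restrict (Set.Icc (0 : ℝ) 1)), 1 / 2 ≤ v := by
    rw [unif_restrict T hT2]
    exact unif_ae_half_le T hT2
  let F : (ℕ → ℝ) → ℕ → (ℝ → ℝ) × (ℝ → ℝ) := fun ε t =>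
    coinFormat K fun j => ε t * roundSign m n t j
  let a : ℕ → (ℕ → ℝ) → ℝ := fun t ε => ∫ v in Set.Icc (0 : ℝ) 1,
    (fun j => if j = 0 then 0 else roundSign m n t j)
      (bidIndex K (A t (fun i : Fin t => F ε i) v)) ∂(unif T)
  obtain ⟨ε, hε, hreg⟩ := exists_signs_blockSum m n T hn0
    (Nat.mul_div_le T m) a (fun t ε ε' h => by
      have : (fun i : Fin t => F ε i) = fun i : Fin t => F ε' i :=
        funext fun i => by simp only [F, h i i.2]
      simp only [a, this])
  have hw : ∀ t j, |ε t * roundSign m n t j| ≤ 1 := by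
    intro t j
    rcases hε t with h | h <;> simpa [h] using abs_roundSign_le m n t j
  refine ⟨F ε, fun t _ => admissible_coinFormat hK0 (hw t), ?_⟩
  set M := ∫ v in Set.Icc (0 : ℝ) 1, (v - 1 / 2) ∂(unif T) with hM
  have hA_le : ∀ t, util (unif T) (F ε t).1 (F ε t).2 (A t fun i : Fin t => F ε i) ≤
      M + ε t * a t ε / 2 := by
    intro t
    refine (util_coinFormat_le hhalf (hw t) (hA t _).1).trans_eq ?_
    rw [← integral_const_mul]
    simp only [mul_ite, mul_zero]
    rfl
  obtain ⟨i, hi, hsign⟩ := exists_bitSign_mul_eq_abs m fun k => blockSum n k T ε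
  have hiK : i + 1 ≤ K := hi.trans_le (Nat.pow_log_le_self 2 (by omega))
  have hbest : ∑ t ∈ Finset.range T, ε t * roundSign m n t (i + 1) =
      ∑ k ∈ Finset.range m, |blockSum n k T ε| := by
    rw [sum_mul_roundSign]
    exact Finset.sum_congr rfl fun k hk => hsign k (Finset.mem_range.1 hk)
  refine (sqrt_mul_log_le hK hT).trans ?_
  refine le_trans ?_ (le_csSup ?_ ⟨fun _ => ((i + 1 : ℕ) : ℝ) / K, measurable_const,
    fun _ _ => ⟨i + 1, hiK, rfl⟩, rfl⟩)
  · calc _ ≤ ∑ t ∈ Finset.range T, (ε t * roundSign m n t (i + 1) - ε t * a t ε) / 2 := by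
          rw [← Finset.sum_div, Finset.sum_sub_distrib, hbest]
          linarith
      _ ≤ _ := by
          refine Finset.sum_le_sum fun t _ => ?_
          have h1 := util_coinFormat_const (μ := unif T) hK0
            (fun j => ε t * roundSign m n t j) (Nat.succ_ne_zero i)
          have h2 := hA_le t
          simp only [F] at h2 ⊢
          linarith
  · refine ⟨∑ t ∈ Finset.range T, (M + 1 / 2 -
      util (unif T) (F ε t).1 (F ε t).2 (A t fun i : Fin t => F ε i)), ?_⟩
    rintro r ⟨s, hs, -, rfl⟩
    refine Finset.sum_le_sum fun t _ => sub_le_sub_right ?_ _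
    refine (util_coinFormat_le hhalf (hw t) hs).trans ?_
    gcongr
    refine integral_bidIndex_le (μ := unif T) (K := K)
      (f := fun j => if j = 0 then 0 else ε t * roundSign m n t j) (fun j => ?_) hs
    split_ifs
    · simp
    · exact hw t j
end
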